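/- arXiv:1610.05457 — 6 statements merged into one kernel-verified Lean document; each statement's English description precedes it below -/
import Mathlib

section
/- Let (P_i)_{i≥1} be one-variable polynomials in k[X], each of degree at least 2. In k[x,y] define f_{-1} = x, f_0 = y, and f_i = f_{i-2} + P_i(f_{i-1}) for i ≥ 1. Then there exist natural numbers d_1 < d_2 < d_3 < … with d_1 = 0, scalars c_i ∈ k^*, and nonconstant one-variable polynomials Q_i ∈ k[X], such that for every i ≥ 1 the polynomial f_i − Q_i(y)·y^{d_i + 1} − c_i·x·y^{d_i} has total degree at most d_i. -/
open MvPolynomial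

/-- Substituting into a one-variable polynomial multiplies the total degree by at most
its degree. -/
lemma totalDegree_aeval_le_natDegree_mul {k σ : Type*} [CommRing k] (p : Polynomial k)
    (g : MvPolynomial σ k) {N : ℕ} (hg : g.totalDegree ≤ N) :
    (Polynomial.aeval g p).totalDegree ≤ p.natDegree * N := by
  rw [Polynomial.aeval_eq_sum_range]
  refine totalDegree_finsetSum_le fun i hi => ?_
  have hi' : i ≤ p.natDegree := by simpa [Nat.lt_succ_iff] using hi
  calc (p.coeff i • g ^ i).totalDegree ≤ (g ^ i).totalDegree := totalDegree_smul_le _ _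
    _ ≤ i * g.totalDegree := totalDegree_pow _ _
    _ ≤ p.natDegree * N := Nat.mul_le_mul hi' hg

/-- Taylor expansion of a polynomial evaluated in an algebra. -/
lemma aeval_add_eq_sum_hasseDeriv {k R : Type*} [CommRing k] [CommRing R] [Algebra k R]
    (p : Polynomial k) (a b : R) :
    Polynomial.aeval (a + b) p = ∑ j ∈ Finset.range (p.natDegree + 1),
      Polynomial.aeval a (Polynomial.hasseDeriv j p) * b ^ j := by
  have h := Polynomial.taylor_eval a (p.map (algebraMap k R)) b
  rw [add_comm a b, ← Polynomial.eval_map_algebraMap, ← h,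
    Polynomial.eval_eq_sum_range' (n := p.natDegree + 1)]
  · refine Finset.sum_congr rfl fun j _ => ?_
    have hmap : Polynomial.hasseDeriv j (p.map (algebraMap k R))
        = (Polynomial.hasseDeriv j p).map (algebraMap k R) := by
      ext n
      simp [Polynomial.hasseDeriv_coeff]
    rw [Polynomial.taylor_coeff, hmap, Polynomial.eval_map_algebraMap]
  · rw [Polynomial.natDegree_taylor]
    exact Nat.lt_succ_of_le Polynomial.natDegree_map_le

/-- Up to total degree `d`, the polynomial `f` is `A(y) + c x y ^ d` with `A` of degree `N`
and `c ≠ 0`. -/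
def HasLeadingForm {k : Type*} [Field k] (f : MvPolynomial (Fin 2) k) (N d : ℕ) : Prop :=
  ∃ (A : Polynomial k) (c : k), c ≠ 0 ∧ A.natDegree = N ∧
    (f - Polynomial.aeval (X 1) A - C c * X 0 * X 1 ^ d).totalDegree ≤ d

namespace HasLeadingForm

variable {k : Type*} [Field k] {f g : MvPolynomial (Fin 2) k} {N d : ℕ}

lemma totalDegree_C_mul_X_mul_X_pow_le (c : k) (d : ℕ) :
    (C c * X 0 * X 1 ^ d : MvPolynomial (Fin 2) k).totalDegree ≤ d + 1 := by
  have h1 := totalDegree_mul (C c * X 0 : MvPolynomial (Fin 2) k) (X 1 ^ d)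
  have h2 := totalDegree_mul (C c : MvPolynomial (Fin 2) k) (X 0)
  simp only [totalDegree_C, totalDegree_X, totalDegree_X_pow] at h1 h2
  omega

lemma totalDegree_aeval_X_le (A : Polynomial k) :
    (Polynomial.aeval (X 1 : MvPolynomial (Fin 2) k) A).totalDegree ≤ A.natDegree := by
  simpa using totalDegree_aeval_le_natDegree_mul A (X 1 : MvPolynomial (Fin 2) k)
    (totalDegree_X (R := k) (1 : Fin 2)).le

lemma totalDegree_le (h : HasLeadingForm f N d) (hd : d + 1 ≤ N) : f.totalDegree ≤ N := by
  obtain ⟨A, c, -, rfl, hR⟩ := h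
  have h1 := totalDegree_aeval_X_le A
  have h2 := totalDegree_C_mul_X_mul_X_pow_le c d
  have hf : f = (f - Polynomial.aeval (X 1) A - C c * X 0 * X 1 ^ d)
      + Polynomial.aeval (X 1) A + C c * X 0 * X 1 ^ d := by ring
  rw [hf]
  refine (totalDegree_add _ _).trans (max_le ((totalDegree_add _ _).trans (max_le ?_ ?_)) ?_) <;>
    omega

/-- The leading form of `g + P(f)`. -/
lemma add_aeval [CharZero k] (h : HasLeadingForm f N d) (hd : d + 2 ≤ N)
    (hg : g.totalDegree ≤ N) (P : Polynomial k) (hP : 2 ≤ P.natDegree) :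
    HasLeadingForm (g + Polynomial.aeval f P) (N * P.natDegree)
      (N * (P.natDegree - 1) + d) := by
  obtain ⟨A, c, hc, hA, hR⟩ := h
  obtain ⟨m, hm⟩ : ∃ m, P.natDegree = m + 2 := ⟨_, (Nat.sub_add_cancel hP).symm⟩
  set R := f - Polynomial.aeval (X 1) A - C c * X 0 * X 1 ^ d with hRdef
  set B := C c * X 0 * X 1 ^ d + R with hB
  have hf : f = Polynomial.aeval (X 1) A + B := by rw [hB, hRdef]; ring
  have hBdeg : B.totalDegree ≤ d + 1 :=
    (totalDegree_add _ _).trans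
      (max_le (totalDegree_C_mul_X_mul_X_pow_le c d) (hR.trans (Nat.le_succ d)))
  set D := P.derivative.comp A with hD
  have hDdeg : D.natDegree = N * (m + 1) := by
    rw [hD, Polynomial.natDegree_comp, Polynomial.natDegree_derivative, hm, hA, mul_comm]
    rfl
  have hN : 2 ≤ N := by omega
  have hD0 : D ≠ 0 := by
    rintro h0
    rw [h0, Polynomial.natDegree_zero] at hDdeg
    nlinarith
  have hpos : 0 < D.natDegree := by rw [hDdeg]; positivity
  have hDsplit : Polynomial.aeval (X 1 : MvPolynomial (Fin 2) k) D
      = Polynomial.aeval (X 1) D.eraseLead + C D.leadingCoeff * X 1 ^ (N * (m + 1)) := by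
    conv_lhs => rw [← D.eraseLead_add_C_mul_X_pow]
    simp [hDdeg, MvPolynomial.algebraMap_eq]
  have htaylor : Polynomial.aeval f P = Polynomial.aeval (X 1) (P.comp A)
      + Polynomial.aeval (X 1) D * B
      + ∑ j ∈ Finset.range (m + 1),
        Polynomial.aeval (Polynomial.aeval (X 1) A) (Polynomial.hasseDeriv (j + 2) P)
          * B ^ (j + 2) := by
    rw [hf, aeval_add_eq_sum_hasseDeriv, hm, Finset.sum_range_succ', Finset.sum_range_succ']
    simp only [hD, Polynomial.aeval_comp, Polynomial.hasseDeriv_zero', zero_add,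
      Polynomial.hasseDeriv_one', pow_zero, pow_one, mul_one]
    ring
  refine ⟨P.comp A, c * D.leadingCoeff, mul_ne_zero hc (Polynomial.leadingCoeff_ne_zero.2 hD0),
    by rw [Polynomial.natDegree_comp, hA, mul_comm], ?_⟩
  have hm1 : P.natDegree - 1 = m + 1 := by omega
  rw [hm1]
  have key : g + Polynomial.aeval f P - Polynomial.aeval (X 1) (P.comp A)
      - C (c * D.leadingCoeff) * X 0 * X 1 ^ (N * (m + 1) + d)
      = g + Polynomial.aeval (X 1) D.eraseLead * (C c * X 0 * X 1 ^ d)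
        + Polynomial.aeval (X 1) D * R
        + ∑ j ∈ Finset.range (m + 1),
          Polynomial.aeval (Polynomial.aeval (X 1) A) (Polynomial.hasseDeriv (j + 2) P)
            * B ^ (j + 2) := by
    rw [htaylor, hB, hDsplit, C_mul, pow_add]
    ring
  rw [key]
  refine (totalDegree_add _ _).trans (max_le ((totalDegree_add _ _).trans
    (max_le ((totalDegree_add _ _).trans (max_le ?_ ?_)) ?_)) ?_)
  · nlinarith
  · have h1 := totalDegree_aeval_X_le D.eraseLead
    have h2 := D.eraseLead_natDegree_le
    refine (totalDegree_mul _ _).trans ?_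
    have h3 := totalDegree_C_mul_X_mul_X_pow_le c d
    omega
  · have h1 := totalDegree_aeval_X_le D
    refine (totalDegree_mul _ _).trans ?_
    omega
  · refine totalDegree_finsetSum_le fun j hj => ?_
    have hj' : j ≤ m := by simpa [Nat.lt_succ_iff] using hj
    obtain ⟨l, rfl⟩ := Nat.exists_eq_add_of_le hj'
    have h1 := totalDegree_aeval_le_natDegree_mul (Polynomial.hasseDeriv (j + 2) P)
      (Polynomial.aeval (X 1 : MvPolynomial (Fin 2) k) A) (totalDegree_aeval_X_le A)
    have h2 := Polynomial.natDegree_hasseDeriv_le P (j + 2)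
    have h3 : (Polynomial.hasseDeriv (j + 2) P).natDegree ≤ l := by omega
    have h4 := Nat.mul_le_mul_right N h3
    have h5 := totalDegree_pow B (j + 2)
    have h6 := Nat.mul_le_mul_left (j + 2) hBdeg
    refine (totalDegree_mul _ _).trans ?_
    rw [hA] at h1
    nlinarith [Nat.mul_le_mul_left j hd]

/-- The part of `A` divisible by `y ^ (d + 1)` suffices in the leading form. -/
lemma exists_aeval_mul_X_pow (h : HasLeadingForm f N d) (hd : d + 2 ≤ N) :
    ∃ (c : k) (Q : Polynomial k), c ≠ 0 ∧ 1 ≤ Q.natDegree ∧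
      (f - Polynomial.aeval (X 1 : MvPolynomial (Fin 2) k) Q * X 1 ^ (d + 1)
        - C c * X 0 * X 1 ^ d).totalDegree ≤ d := by
  obtain ⟨A, c, hc, hA, hR⟩ := h
  have hmonic : (Polynomial.X ^ (d + 1) : Polynomial k).Monic := Polynomial.monic_X_pow _
  refine ⟨c, A /ₘ Polynomial.X ^ (d + 1), hc, ?_, ?_⟩
  · rw [Polynomial.natDegree_divByMonic _ hmonic, Polynomial.natDegree_X_pow]
    omega
  · have hlow : (A %ₘ Polynomial.X ^ (d + 1)).natDegree < d + 1 := by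
      simpa using Polynomial.natDegree_modByMonic_lt A hmonic
        (fun h => by simpa using congrArg Polynomial.natDegree h)
    have hsplit := congrArg (Polynomial.aeval (X 1 : MvPolynomial (Fin 2) k))
      (Polynomial.modByMonic_add_div A (Polynomial.X ^ (d + 1)))
    simp only [map_add, map_mul, map_pow, Polynomial.aeval_X] at hsplit
    have key : f - Polynomial.aeval (X 1) (A /ₘ Polynomial.X ^ (d + 1)) * X 1 ^ (d + 1)
        - C c * X 0 * X 1 ^ d
        = (f - Polynomial.aeval (X 1) A - C c * X 0 * X 1 ^ d)
          + Polynomial.aeval (X 1) (A %ₘ Polynomial.X ^ (d + 1)) := by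
      rw [← hsplit]; ring
    rw [key]
    exact (totalDegree_add _ _).trans (max_le hR
      ((totalDegree_aeval_X_le _).trans (Nat.le_of_lt_succ hlow)))

end HasLeadingForm

/-- Leading terms along a path in the tree: given polynomials `P_i` of degree ≥ 2 and the
sequence `f_{-1} = x`, `f_0 = y`, `f_i = f_{i-2} + P_i(f_{i-1})`, there are strictly
increasing exponents `d_i` with `d_1 = 0`, scalars `c_i ∈ k^*` and nonconstant `Q_i` with
`f_i = Q_i(y)·y^{d_i+1} + c_i·x·y^{d_i} + (terms of total degree ≤ d_i)`.
Here `f i` denotes `f_{i-1}`. -/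
theorem leading_terms_of_path (k : Type) [Field k] [CharZero k]
    (P : ℕ → Polynomial k) (hP : ∀ i, 1 ≤ i → 2 ≤ (P i).natDegree)
    (f : ℕ → MvPolynomial (Fin 2) k)
    (hf0 : f 0 = X 0) (hf1 : f 1 = X 1)
    (hfrec : ∀ i, f (i + 2) = f i + Polynomial.aeval (f (i + 1)) (P (i + 1))) :
    ∃ (d : ℕ → ℕ) (c : ℕ → k) (Q : ℕ → Polynomial k),
      d 1 = 0 ∧ (∀ i j, 1 ≤ i → i < j → d i < d j) ∧
      ∀ i, 1 ≤ i → c i ≠ 0 ∧ 1 ≤ (Q i).natDegree ∧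
        (f (i + 1) - Polynomial.aeval (X 1 : MvPolynomial (Fin 2) k) (Q i) * X 1 ^ (d i + 1)
          - C (c i) * X 0 * X 1 ^ (d i)).totalDegree ≤ d i := by
  set N : ℕ → ℕ := fun i => ∏ j ∈ Finset.range i, (P (j + 1)).natDegree with hN
  set d : ℕ → ℕ := fun i => N i - N 1 with hd
  have hNsucc : ∀ i, N (i + 1) = N i * (P (i + 1)).natDegree := fun i =>
    Finset.prod_range_succ _ _
  have hN0 : N 0 = 1 := Finset.prod_range_zero _
  have hN1 : N 1 = (P 1).natDegree := by rw [hNsucc, hN0, one_mul]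
  have hP1 := hP 1 le_rfl
  have hNpos : ∀ i, 0 < N i := fun i =>
    Finset.prod_pos fun j _ => by have := hP (j + 1) (by omega); omega
  have hNmono : StrictMono N := strictMono_nat_of_lt_succ fun i => by
    rw [hNsucc]
    nlinarith [hP (i + 1) (by omega), hNpos i]
  have hNle : ∀ i, N 1 ≤ N (i + 1) := fun i => hNmono.monotone (by omega)
  have hdN : ∀ i, d (i + 1) + 2 ≤ N (i + 1) := fun i => by
    have := hNle i
    simp only [hd]
    omega
  have main : ∀ i, (f (i + 1)).totalDegree ≤ N (i + 1) ∧
      HasLeadingForm (f (i + 2)) (N (i + 1)) (d (i + 1)) := by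
    intro i
    induction i with
    | zero =>
      refine ⟨?_, P 1, 1, one_ne_zero, hN1.symm, ?_⟩
      · rw [zero_add, hf1, totalDegree_X, hN1]
        omega
      · simp [hd, hfrec, hf0, hf1]
    | succ i ih =>
      obtain ⟨hg, hform⟩ := ih
      refine ⟨(hform.totalDegree_le (by have := hdN i; omega)).trans
        (hNmono.monotone (Nat.le_succ _)), ?_⟩
      have hPi := hP (i + 2) (by omega)
      have hstep := hform.add_aeval (hdN i) hg (P (i + 2)) hPi
      have hdsucc : d (i + 2) = N (i + 1) * ((P (i + 2)).natDegree - 1) + d (i + 1) := by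
        have h1 := hNle i
        have h2 := hNsucc (i + 1)
        obtain ⟨m, hm⟩ := Nat.exists_eq_add_of_le hPi
        simp only [hd]
        rw [h2, show i + 1 + 1 = i + 2 from rfl, hm,
          show 2 + m - 1 = m + 1 by omega, show 2 + m = m + 1 + 1 by omega, Nat.mul_succ]
        omega
      rw [show i + 1 + 2 = i + 1 + 1 + 1 from rfl, hfrec (i + 1), hNsucc (i + 1), hdsucc]
      exact hstep
  have hQ : ∀ i, ∃ (c : k) (Q : Polynomial k), 1 ≤ i → c ≠ 0 ∧ 1 ≤ Q.natDegree ∧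
      (f (i + 1) - Polynomial.aeval (X 1 : MvPolynomial (Fin 2) k) Q * X 1 ^ (d i + 1)
        - C c * X 0 * X 1 ^ (d i)).totalDegree ≤ d i := by
    rintro (_ | i)
    · exact ⟨0, 0, fun h => absurd h (by omega)⟩
    · obtain ⟨c, Q, h⟩ := (main i).2.exists_aeval_mul_X_pow (hdN i)
      exact ⟨c, Q, fun _ => h⟩
  choose c Q hcQ using hQ
  refine ⟨d, c, Q, Nat.sub_self _, fun i j hi hij => ?_, hcQ⟩
  have h1 := hNmono hij
  have h2 := hNmono.monotone hi
  simp only [hd]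
  omega
end

section
/- Let f ∈ k[x,y] and suppose there exist a natural number d ≥ 0, a scalar c ∈ k^*, and a nonconstant one-variable polynomial Q ∈ k[X] such that f − Q(y)·y^{d+1} − c·x·y^{d} has total degree at most d. Then for every nonconstant one-variable polynomial A ∈ k[X], there exist a natural number d' ≥ 0, a scalar c' ∈ k^*, and a nonconstant Q' ∈ k[X] such that A(f) − Q'(y)·y^{d'+1} − c'·x·y^{d'} has total degree at most d'. -/
open MvPolynomial

lemma totalDegree_aeval_X_le {k σ : Type*} [Field k] (i : σ) (p : Polynomial k) :
    (Polynomial.aeval (X i : MvPolynomial σ k) p).totalDegree ≤ p.natDegree := by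
  rw [Polynomial.aeval_eq_sum_range]
  refine totalDegree_finsetSum_le fun j hj => ?_
  refine (totalDegree_smul_le _ _).trans ?_
  rw [totalDegree_X_pow]
  exact Nat.lt_succ_iff.mp (Finset.mem_range.mp hj)

/-- First-order expansion of a power, with a degree bound on the remainder. -/
lemma totalDegree_pow_sub_linear_le {k σ : Type*} [Field k] {f p h : MvPolynomial σ k} {d N : ℕ}
    (hN : d + 2 ≤ N) (hp : p.totalDegree ≤ N) (hh : h.totalDegree ≤ d + 1)
    (hfg : (f - p - h).totalDegree ≤ d) (n : ℕ) :
    (f ^ (n + 1) - p ^ (n + 1) - (n + 1 : MvPolynomial σ k) * h * p ^ n).totalDegree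
      ≤ n * N + d := by
  induction n with
  | zero => simpa using hfg
  | succ n ih =>
    set R := f ^ (n + 1) - p ^ (n + 1) - (n + 1 : MvPolynomial σ k) * h * p ^ n
    set g := f - p - h
    have hf : f.totalDegree ≤ N := by
      have : f = p + h + g := by simp only [g]; ring
      rw [this]
      refine (totalDegree_add _ _).trans (max_le ((totalDegree_add _ _).trans ?_) ?_)
      · exact max_le hp (by omega)
      · omega
    have hpn : ∀ m, (p ^ m).totalDegree ≤ m * N := fun m =>
      (totalDegree_pow _ _).trans (Nat.mul_le_mul_left _ hp)
    have hc : (n + 1 : MvPolynomial σ k).totalDegree = 0 := by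
      have : (n + 1 : MvPolynomial σ k) = C (n + 1 : k) := by simp
      rw [this, totalDegree_C]
    have key : f ^ (n + 1 + 1) - p ^ (n + 1 + 1)
        - ((n + 1 : ℕ) + 1 : MvPolynomial σ k) * h * p ^ (n + 1)
        = f * R + g * p ^ (n + 1) + (n + 1 : MvPolynomial σ k) * (g + h) * (h * p ^ n) := by
      simp only [R, g]; push_cast; ring
    have e : (n + 1) * N = n * N + N := by ring
    have hgh : (g + h).totalDegree ≤ d + 1 :=
      (totalDegree_add _ _).trans (max_le (by omega) hh)
    rw [key]
    refine (totalDegree_add _ _).trans (max_le ((totalDegree_add _ _).trans (max_le ?_ ?_)) ?_)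
    · have := totalDegree_mul f R
      omega
    · have := totalDegree_mul g (p ^ (n + 1))
      have := hpn (n + 1)
      omega
    · have := totalDegree_mul ((n + 1 : MvPolynomial σ k) * (g + h)) (h * p ^ n)
      have := totalDegree_mul (n + 1 : MvPolynomial σ k) (g + h)
      have := totalDegree_mul h (p ^ n)
      have := hpn n
      omega

/-- First-order Taylor expansion of `A(f)` at `p`, with a degree bound on the remainder. -/
lemma totalDegree_aeval_sub_linear_le {k σ : Type*} [Field k] {f p h : MvPolynomial σ k}
    {d N : ℕ} (hN : d + 2 ≤ N) (hp : p.totalDegree ≤ N) (hh : h.totalDegree ≤ d + 1)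
    (hfg : (f - p - h).totalDegree ≤ d) (A : Polynomial k) :
    (Polynomial.aeval f A - Polynomial.aeval p A
      - h * Polynomial.aeval p (Polynomial.derivative A)).totalDegree
      ≤ (A.natDegree - 1) * N + d := by
  have key : Polynomial.aeval f A - Polynomial.aeval p A
      - h * Polynomial.aeval p (Polynomial.derivative A)
      = ∑ i ∈ Finset.range (A.natDegree + 1), A.coeff i •
        (f ^ i - p ^ i - (i : MvPolynomial σ k) * h * p ^ (i - 1)) := by
    have hder : Polynomial.aeval p (Polynomial.derivative A)
        = ∑ i ∈ Finset.range (A.natDegree + 1), A.coeff i •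
          ((i : MvPolynomial σ k) * p ^ (i - 1)) := by
      conv_lhs => rw [A.as_sum_range_C_mul_X_pow]
      simp [Polynomial.derivative_X_pow, smul_eq_C_mul, algebraMap_eq]
    rw [hder, Polynomial.aeval_eq_sum_range, Polynomial.aeval_eq_sum_range, Finset.mul_sum,
      ← Finset.sum_sub_distrib, ← Finset.sum_sub_distrib]
    refine Finset.sum_congr rfl fun i _ => ?_
    simp only [smul_eq_C_mul]
    ring
  rw [key]
  refine totalDegree_finsetSum_le fun i hi => (totalDegree_smul_le _ _).trans ?_
  have hi' := Finset.mem_range.mp hi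
  rcases i with _ | i
  · simp
  · have := totalDegree_pow_sub_linear_le hN hp hh hfg i
    push_cast
    refine this.trans (Nat.add_le_add_right (Nat.mul_le_mul_right _ (by omega)) _)

theorem substitution_keeps_form (k : Type) [Field k] [CharZero k]
    (f : MvPolynomial (Fin 2) k)
    (hf : ∃ (d : ℕ) (c : k) (Q : Polynomial k), c ≠ 0 ∧ 1 ≤ Q.natDegree ∧
      (f - Polynomial.aeval (X 1 : MvPolynomial (Fin 2) k) Q * X 1 ^ (d + 1)
        - C c * X 0 * X 1 ^ d).totalDegree ≤ d)
    (A : Polynomial k) (hA : 1 ≤ A.natDegree) :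
    ∃ (d' : ℕ) (c' : k) (Q' : Polynomial k), c' ≠ 0 ∧ 1 ≤ Q'.natDegree ∧
      (Polynomial.aeval f A
        - Polynomial.aeval (X 1 : MvPolynomial (Fin 2) k) Q' * X 1 ^ (d' + 1)
        - C c' * X 0 * X 1 ^ d').totalDegree ≤ d' := by
  obtain ⟨d, c, Q, hc, hQ, hf⟩ := hf
  set y : MvPolynomial (Fin 2) k := X 1
  set P : Polynomial k := Q * Polynomial.X ^ (d + 1) with hP
  have hQ0 : Q ≠ 0 := by rintro rfl; simp at hQ
  have hPdeg : P.natDegree = Q.natDegree + (d + 1) := Polynomial.natDegree_mul_X_pow _ hQ0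
  have hPy : Polynomial.aeval y P = Polynomial.aeval y Q * y ^ (d + 1) := by simp [hP]
  set T := (Polynomial.derivative A).comp P with hT
  set S := A.comp P with hS
  have hdA : (Polynomial.derivative A).natDegree = A.natDegree - 1 :=
    Polynomial.natDegree_derivative A
  have hTdeg : T.natDegree = (A.natDegree - 1) * P.natDegree := by
    rw [hT, Polynomial.natDegree_comp, hdA]
  have hSdeg : S.natDegree = (A.natDegree - 1) * P.natDegree + P.natDegree := by
    rw [hS, Polynomial.natDegree_comp, ← Nat.succ_mul]
    congr 1; omega
  have hT0 : T ≠ 0 := by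
    intro h0
    rw [hT, Polynomial.comp_eq_zero_iff] at h0
    rcases h0 with h0 | ⟨-, h0⟩
    · have := Polynomial.derivative_eq_zero.mp h0
      omega
    · have := congrArg Polynomial.natDegree h0
      rw [Polynomial.natDegree_C] at this
      omega
  set d' := T.natDegree + d with hd'
  have hmonic : (Polynomial.X ^ (d' + 1) : Polynomial k).Monic := Polynomial.monic_X_pow _
  refine ⟨d', c * T.leadingCoeff, S /ₘ Polynomial.X ^ (d' + 1),
    mul_ne_zero hc (Polynomial.leadingCoeff_ne_zero.mpr hT0), ?_, ?_⟩
  · rw [Polynomial.natDegree_divByMonic _ hmonic, Polynomial.natDegree_X_pow]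
    omega
  have hh : (C c * X 0 * y ^ d).totalDegree ≤ d + 1 := by
    have h1 := totalDegree_mul (C c * X 0) (y ^ d)
    have h2 := totalDegree_mul (C c) (X 0 : MvPolynomial (Fin 2) k)
    rw [totalDegree_C, totalDegree_X] at h2
    rw [totalDegree_X_pow] at h1
    omega
  have hmain := totalDegree_aeval_sub_linear_le (N := P.natDegree) (by omega)
    (totalDegree_aeval_X_le (1 : Fin 2) P) hh (by rwa [hPy]) A
  rw [← hTdeg, ← Polynomial.aeval_comp, ← Polynomial.aeval_comp] at hmain
  have hSmod : Polynomial.aeval y S = Polynomial.aeval y (S %ₘ Polynomial.X ^ (d' + 1))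
      + y ^ (d' + 1) * Polynomial.aeval y (S /ₘ Polynomial.X ^ (d' + 1)) := by
    conv_lhs => rw [← Polynomial.modByMonic_add_div S (Polynomial.X ^ (d' + 1))]
    simp
  have hTlead : Polynomial.aeval y T = Polynomial.aeval y T.eraseLead
      + C T.leadingCoeff * y ^ T.natDegree := by
    have := congrArg (Polynomial.aeval y) T.eraseLead_add_C_mul_X_pow
    simp only [map_add, map_mul, map_pow, Polynomial.aeval_X, Polynomial.aeval_C,
      algebraMap_eq] at this
    exact this.symm
  have key : Polynomial.aeval f A
        - Polynomial.aeval y (S /ₘ Polynomial.X ^ (d' + 1)) * y ^ (d' + 1)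
        - C (c * T.leadingCoeff) * X 0 * y ^ d'
      = (Polynomial.aeval f A - Polynomial.aeval y S - C c * X 0 * y ^ d * Polynomial.aeval y T)
        + Polynomial.aeval y (S %ₘ Polynomial.X ^ (d' + 1))
        + C c * X 0 * y ^ d * Polynomial.aeval y T.eraseLead := by
    rw [hSmod, hTlead, C_mul, hd']; ring
  rw [key]
  refine (totalDegree_add _ _).trans (max_le ((totalDegree_add _ _).trans (max_le hmain ?_)) ?_)
  · refine (totalDegree_aeval_X_le _ _).trans ?_
    have := Polynomial.natDegree_modByMonic_lt S hmonic (by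
      intro h1
      have := congrArg Polynomial.natDegree h1
      simp at this)
    rw [Polynomial.natDegree_X_pow] at this
    omega
  · rcases eq_or_ne T.eraseLead 0 with h0 | h0
    · simp [h0]
    · have h1 := totalDegree_mul (C c * X 0 * y ^ d) (Polynomial.aeval y T.eraseLead)
      have h2 := totalDegree_aeval_X_le (1 : Fin 2) T.eraseLead
      have h3 := Polynomial.eraseLead_natDegree_lt_or_eraseLead_eq_zero T
      have h4 := h3.resolve_right h0
      change (Polynomial.aeval y T.eraseLead).totalDegree ≤ _ at h2
      omega
end

section
/- Let F, G ∈ k[x,y] and S ∈ k[X]. Suppose there exist c ∈ k^* and an integer d ≥ 2 such that F − c·x^d has total degree strictly less than d, and suppose there exist c' ∈ k^*, a natural number d' ≥ 0, and a nonconstant one-variable polynomial H ∈ k[X] such that G − H(y)·y^{d'} − c'·x·y^{d'} has total degree at most d'. Then F + G + S(y) ≠ 0. -/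
open MvPolynomial

/-- A polynomial in the variable `X i` alone has no monomial involving another variable. -/
theorem coeff_aeval_X_eq_zero {σ R : Type*} [CommSemiring R] {i j : σ} (hij : i ≠ j)
    (P : Polynomial R) (m : σ →₀ ℕ) (hm : m j ≠ 0) :
    coeff m (Polynomial.aeval (X i : MvPolynomial σ R) P) = 0 := by
  classical
  rw [Polynomial.aeval_eq_sum_range, coeff_sum]
  refine Finset.sum_eq_zero fun n _ => ?_
  rw [coeff_smul, coeff_X_pow, if_neg, smul_zero]
  rintro rfl
  exact hm (Finsupp.single_eq_of_ne hij.symm)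

/-- If `F = c·x^d + (lower total degree)` with `d ≥ 2` and
`G = H(y)·y^{d'} + c'·x·y^{d'} + (terms of total degree ≤ d')` with `H` nonconstant,
then `F + G + S(y) ≠ 0` for any one-variable polynomial `S`. -/
theorem no_cancellation (k : Type) [Field k] [CharZero k]
    (F G : MvPolynomial (Fin 2) k) (S : Polynomial k)
    (hF : ∃ (c : k) (d : ℕ), c ≠ 0 ∧ 2 ≤ d ∧ (F - C c * X 0 ^ d).totalDegree < d)
    (hG : ∃ (c' : k) (d' : ℕ) (H : Polynomial k), c' ≠ 0 ∧ 1 ≤ H.natDegree ∧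
      (G - Polynomial.aeval (X 1 : MvPolynomial (Fin 2) k) H * X 1 ^ d'
        - C c' * X 0 * X 1 ^ d').totalDegree ≤ d') :
    F + G + Polynomial.aeval (X 1 : MvPolynomial (Fin 2) k) S ≠ 0 := by
  obtain ⟨c, d, hc, hd, hF⟩ := hF
  obtain ⟨c', d', H, hc', -, hG⟩ := hG
  intro h
  have hH : Polynomial.aeval (X 1 : MvPolynomial (Fin 2) k) H * X 1 ^ d'
      = Polynomial.aeval (X 1) (H * Polynomial.X ^ d') := by simp
  have hx : C c * X 0 ^ d = monomial (Finsupp.single (0 : Fin 2) d) c :=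
    C_mul_X_pow_eq_monomial
  have hxy : C c' * X 0 * X 1 ^ d'
      = monomial (Finsupp.single (0 : Fin 2) 1 + Finsupp.single 1 d') c' := by
    rw [C_mul_X_eq_monomial, X_pow_eq_monomial, monomial_mul, mul_one]
  rw [hx] at hF
  rw [hH, hxy] at hG
  have hne : Finsupp.single (0 : Fin 2) 1 + Finsupp.single 1 d' ≠ Finsupp.single 0 d := by
    intro e
    have := DFunLike.congr_fun e 0
    simp at this
    omega
  have hcoeff (m : Fin 2 →₀ ℕ) (hm : m 0 ≠ 0) : coeff m F + coeff m G = 0 := by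
    have := congrArg (coeff m) h
    rwa [coeff_add, coeff_add, coeff_aeval_X_eq_zero (by decide) S m hm, add_zero,
      coeff_zero] at this
  have hFm (m : Fin 2 →₀ ℕ) (hm : d ≤ m.degree) :
      coeff m F = coeff m (monomial (Finsupp.single (0 : Fin 2) d) c) := by
    rw [← sub_eq_zero, ← coeff_sub]
    exact coeff_eq_zero_of_totalDegree_lt (hF.trans_le hm)
  have hGm (m : Fin 2 →₀ ℕ) (hm0 : m 0 ≠ 0) (hm : d' < m.degree) :
      coeff m G = coeff m (monomial (Finsupp.single (0 : Fin 2) 1 + Finsupp.single 1 d') c') := by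
    have := coeff_eq_zero_of_totalDegree_lt (hG.trans_lt hm)
    rwa [coeff_sub, coeff_sub, coeff_aeval_X_eq_zero (by decide) _ m hm0, sub_zero,
      sub_eq_zero] at this
  rcases lt_or_ge d' d with hlt | hle
  · have h0 : Finsupp.single (0 : Fin 2) d 0 ≠ 0 := by simp; omega
    have := hcoeff _ h0
    rw [hFm _ (by simp), hGm _ h0 (by simpa using hlt), coeff_monomial, coeff_monomial,
      if_pos rfl, if_neg hne, add_zero] at this
    exact hc this
  · have h0 : (Finsupp.single 0 1 + Finsupp.single 1 d' : Fin 2 →₀ ℕ) 0 ≠ 0 := by simp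
    have := hcoeff _ h0
    rw [hFm _ (by simp; omega), hGm _ h0 (by simp), coeff_monomial, coeff_monomial,
      if_pos rfl, if_neg hne.symm, zero_add] at this
    exact hc' this
end

section
/- There do not exist a k-algebra automorphism σ of k[x,y], a one-variable polynomial A ∈ k[X], and a one-variable polynomial S ∈ k[X] such that x·y + S(y) + A(σ(x)) = 0 in k[x,y]. -/
open MvPolynomial

namespace MvPolynomial

theorem mem_supported_compl_singleton_iff {σ R : Type*} [CommSemiring R] {i : σ}
    {p : MvPolynomial σ R} : p ∈ supported R {i}ᶜ ↔ p.degreeOf i = 0 := by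
  classical
  rw [mem_supported, Set.subset_compl_singleton_iff, Finset.mem_coe, degreeOf_def,
    Multiset.count_eq_zero, vars_def, Multiset.mem_toFinset]

/-- The polynomials not involving the variable `i` form a factorially closed subring. -/
theorem mem_supported_of_mul_mem {σ R : Type*} [CommRing R] [IsDomain R] {i : σ}
    {p q : MvPolynomial σ R} (h : p * q ∈ supported R {i}ᶜ) (h0 : p * q ≠ 0) :
    p ∈ supported R {i}ᶜ ∧ q ∈ supported R {i}ᶜ := by
  rw [mem_supported_compl_singleton_iff] at *
  rw [degreeOf_mul_eq (left_ne_zero_of_mul h0) (right_ne_zero_of_mul h0)] at h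
  rw [mem_supported_compl_singleton_iff]
  omega

end MvPolynomial

/-- There is no `k`-algebra automorphism `σ` of `k[x,y]` and one-variable polynomials
`A, S` with `x·y + S(y) + A(σ(x)) = 0`. -/
theorem no_outgoing_arrow (k : Type) [Field k] [CharZero k] :
    ¬ ∃ (σ : MvPolynomial (Fin 2) k ≃ₐ[k] MvPolynomial (Fin 2) k) (A S : Polynomial k),
      (X 0 : MvPolynomial (Fin 2) k) * X 1
        + Polynomial.aeval (X 1 : MvPolynomial (Fin 2) k) S
        + Polynomial.aeval (σ (X 0)) A = 0 := by
  rintro ⟨σ, A, S, h⟩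
  let B : Subalgebra k (MvPolynomial (Fin 2) k) := supported k {1}ᶜ
  have aeval_mem {b : MvPolynomial (Fin 2) k} (hb : b ∈ B) (P : Polynomial k) :
      Polynomial.aeval b P ∈ B :=
    Algebra.adjoin_le (Set.singleton_subset_iff.2 hb) (Polynomial.aeval_mem_adjoin_singleton k b)
  have hX0 : (X 0 : MvPolynomial (Fin 2) k) ∈ B := X_mem_supported.2 (by simp)
  have hX1 : (X 1 : MvPolynomial (Fin 2) k) ∉ B := fun hm => by
    simpa using X_mem_supported.1 hm
  have hS : Polynomial.aeval (X 1 : MvPolynomial (Fin 2) k) S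
      = X 1 * Polynomial.aeval (X 1 : MvPolynomial (Fin 2) k) S.divX + C (S.coeff 0) := by
    have := congrArg (Polynomial.aeval (X 1 : MvPolynomial (Fin 2) k)) (Polynomial.X_mul_divX_add S)
    rw [← this, map_add, map_mul, Polynomial.aeval_X, Polynomial.aeval_C, algebraMap_eq]
  set T := S.divX
  have hprod : (X 1 : MvPolynomial (Fin 2) k) * (X 0 + Polynomial.aeval (X 1) T)
      = -Polynomial.aeval (σ (X 0)) A - C (S.coeff 0) := by
    linear_combination h - hS
  have hne : (X 0 : MvPolynomial (Fin 2) k) + Polynomial.aeval (X 1) T ≠ 0 := fun h0 => by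
    have := congrArg (aeval ![(1 : MvPolynomial (Fin 2) k) - Polynomial.aeval 0 T, 0]) h0
    simp [← Polynomial.aeval_algHom_apply] at this
  have hmap : σ.symm (X 1) * σ.symm (X 0 + Polynomial.aeval (X 1) T) ∈ B := by
    rw [← map_mul, hprod, map_sub, map_neg, ← Polynomial.aeval_algHom_apply,
      AlgEquiv.symm_apply_apply, ← algebraMap_eq, AlgEquiv.commutes]
    exact sub_mem (neg_mem (aeval_mem hX0 A)) (B.algebraMap_mem _)
  obtain ⟨h1, h2⟩ := mem_supported_of_mul_mem hmap
    (mul_ne_zero (by simp) (by simpa only [ne_eq, EmbeddingLike.map_eq_zero_iff] using hne))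
  have h0 : σ.symm (X 0) ∈ B := by
    rw [map_add, ← Polynomial.aeval_algHom_apply] at h2
    exact (add_mem_cancel_right (aeval_mem h1 T)).1 h2
  have hle : (⊤ : Subalgebra k (MvPolynomial (Fin 2) k)) ≤ B.comap σ.symm.toAlgHom := by
    rw [← adjoin_range_X, Algebra.adjoin_le_iff]
    rintro _ ⟨i, rfl⟩
    fin_cases i
    · exact h0
    · exact h1
  have hmem : σ.symm (σ (X 1)) ∈ B := hle (Algebra.mem_top (x := σ (X 1)))
  exact hX1 (by simpa using hmem)
end

section
/- Let B, D, E, F ∈ k[X] be one-variable polynomials with deg B ≥ 2, deg D ≥ 2, deg E ≥ 2, and deg F ≥ 2. Then in k[x,y] one has B'(x)·E''(y + B(x)) ≠ D'(y)·F''(x + D(y)), where B' denotes the derivative of B and E'' the second derivative of E. -/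
open MvPolynomial Polynomial

/-- Evaluating a polynomial over `k` at an element `g` of `k[X][Y]` is composition with `g`
after mapping the coefficients to `k[X]`. -/
lemma aeval_eq_map_C_comp {k : Type*} [Field k] (P : Polynomial k)
    (g : Polynomial (Polynomial k)) :
    Polynomial.aeval g P = (P.map Polynomial.C).comp g := by
  rw [Polynomial.comp, Polynomial.eval₂_map, Polynomial.aeval_def]
  rfl

lemma natDegree_aeval_bivariate {k : Type*} [Field k] (P : Polynomial k)
    (g : Polynomial (Polynomial k)) :
    (Polynomial.aeval g P).natDegree = P.natDegree * g.natDegree := by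
  rw [aeval_eq_map_C_comp, Polynomial.natDegree_comp,
    Polynomial.natDegree_map_eq_of_injective Polynomial.C_injective]

lemma aeval_C_X_eq_C {k : Type*} [Field k] (B : Polynomial k) :
    Polynomial.aeval (Polynomial.C (Polynomial.X : Polynomial k)) B = Polynomial.C B := by
  have h := Polynomial.aeval_algHom_apply
    (Polynomial.CAlgHom (R := k) (A := Polynomial k)) Polynomial.X B
  simpa using h

/-- Comparing degrees in `v` in `b(u)·P(v + B(u)) = c(v)·Q(u + D(v))`, where `{u, v}` are the
two variables. -/
lemma natDegree_eq_of_relation {k : Type*} [Field k] {i j : Fin 2} (hij : i ≠ j)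
    {b B c D P Q : Polynomial k} (hb : b ≠ 0) (hP : P ≠ 0)
    (h : Polynomial.aeval (MvPolynomial.X i : MvPolynomial (Fin 2) k) b
        * Polynomial.aeval ((MvPolynomial.X j : MvPolynomial (Fin 2) k)
            + Polynomial.aeval (MvPolynomial.X i : MvPolynomial (Fin 2) k) B) P
      = Polynomial.aeval (MvPolynomial.X j : MvPolynomial (Fin 2) k) c
        * Polynomial.aeval ((MvPolynomial.X i : MvPolynomial (Fin 2) k)
            + Polynomial.aeval (MvPolynomial.X j : MvPolynomial (Fin 2) k) D) Q) :
    P.natDegree = c.natDegree + Q.natDegree * D.natDegree := by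
  let φ : MvPolynomial (Fin 2) k →ₐ[k] Polynomial (Polynomial k) :=
    MvPolynomial.aeval fun l => if l = i then Polynomial.C Polynomial.X else Polynomial.X
  have hi : φ (MvPolynomial.X i) = Polynomial.C Polynomial.X := by simp [φ]
  have hj : φ (MvPolynomial.X j) = Polynomial.X := by simp [φ, hij.symm]
  have h' := congrArg φ h
  simp only [map_mul, ← Polynomial.aeval_algHom_apply, map_add, hi, hj, aeval_C_X_eq_C] at h'
  have hl : (Polynomial.X + Polynomial.C B : Polynomial (Polynomial k)).natDegree = 1 :=
    Polynomial.natDegree_X_add_C B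
  have hr : (Polynomial.C Polynomial.X + Polynomial.aeval Polynomial.X D :
      Polynomial (Polynomial k)).natDegree = D.natDegree := by
    rw [Polynomial.natDegree_C_add, natDegree_aeval_bivariate, Polynomial.natDegree_X, mul_one]
  have hP' : Polynomial.aeval (Polynomial.X + Polynomial.C B) P ≠ 0 := by
    rw [aeval_eq_map_C_comp, Ne, Polynomial.comp_eq_zero_iff]
    rintro (h0 | ⟨-, h0⟩)
    · exact hP ((Polynomial.map_eq_zero_iff Polynomial.C_injective).1 h0)
    · rw [h0, Polynomial.natDegree_C] at hl
      exact zero_ne_one hl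
  have hne := mul_ne_zero (Polynomial.C_ne_zero.2 hb) hP'
  have hne' := hne
  rw [h'] at hne'
  have hdeg := congrArg Polynomial.natDegree h'
  rw [Polynomial.natDegree_mul (left_ne_zero_of_mul hne) hP',
    Polynomial.natDegree_mul (left_ne_zero_of_mul hne') (right_ne_zero_of_mul hne')] at hdeg
  simpa [natDegree_aeval_bivariate, hl, hr] using hdeg

/-- For one-variable polynomials `B, D, E, F` of degree at least 2, in `k[x,y]` one has
`B'(x)·E''(y + B(x)) ≠ D'(y)·F''(x + D(y))`. -/
theorem no_second_derivative_relation (k : Type) [Field k] [CharZero k]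
    (B D E F : Polynomial k)
    (hB : 2 ≤ B.natDegree) (hD : 2 ≤ D.natDegree)
    (hE : 2 ≤ E.natDegree) (hF : 2 ≤ F.natDegree) :
    Polynomial.aeval (MvPolynomial.X 0 : MvPolynomial (Fin 2) k) (derivative B)
        * Polynomial.aeval ((MvPolynomial.X 1 : MvPolynomial (Fin 2) k)
            + Polynomial.aeval (MvPolynomial.X 0 : MvPolynomial (Fin 2) k) B)
          (derivative (derivative E))
      ≠ Polynomial.aeval (MvPolynomial.X 1 : MvPolynomial (Fin 2) k) (derivative D)
        * Polynomial.aeval ((MvPolynomial.X 0 : MvPolynomial (Fin 2) k)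
            + Polynomial.aeval (MvPolynomial.X 1 : MvPolynomial (Fin 2) k) D)
          (derivative (derivative F)) := by
  intro h
  have natDegree_deriv (p : Polynomial k) : (derivative p).natDegree = p.natDegree - 1 :=
    Polynomial.natDegree_derivative p
  have deriv_ne {p : Polynomial k} (hp : 1 ≤ p.natDegree) : derivative p ≠ 0 := fun h0 => by
    have := Polynomial.derivative_eq_zero.1 h0
    omega
  have hB' := deriv_ne (p := B) (by omega)
  have hD' := deriv_ne (p := D) (by omega)
  have hE' := deriv_ne (p := derivative E) (by rw [natDegree_deriv]; omega)
  have hF' := deriv_ne (p := derivative F) (by rw [natDegree_deriv]; omega)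
  have h1 := natDegree_eq_of_relation (by decide) hB' hE' h
  have h2 := natDegree_eq_of_relation (by decide) hD' hF' h.symm
  rw [natDegree_deriv D] at h1
  rw [natDegree_deriv B] at h2
  have h3 := Nat.le_mul_of_pos_right (derivative (derivative F)).natDegree
    (show 0 < D.natDegree by omega)
  have h4 := Nat.le_mul_of_pos_right (derivative (derivative E)).natDegree
    (show 0 < B.natDegree by omega)
  omega
end

section
/- Let n ≥ 2 be an even integer. Let a, c, e, α, α' ∈ k^*, let b, d, β, β' ∈ k, and let R ∈ k[x1,x3] ⊆ k[x1,x2,x3]. Suppose that in k[x1,x2,x3] the following two identities hold: (a·x1 + b)·P_{n-1}(c·x3 + d) + (e·x2 + R)·P_n(c·x3 + d) = α·(x1·P_{n-1}(x3) + x2·P_n(x3)) + β, and Q_n(a·x1 + b)·(e·x2 + R) + Q_{n-1}(a·x1 + b)·(c·x3 + d) = α'·(Q_n(x1)·x2 + Q_{n-1}(x1)·x3) + β'. Then R = 0, b = 0, d = 0, a² = 1, c² = 1, and α = α' = e = c·a. -/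
open MvPolynomial

/-- `Pseq k n` is the polynomial `P_{n-1}`: `P_{-1} = 0`, `P_0 = 1`,
`P_n = X·P_{n-1} + P_{n-2}` for `n ≥ 1`. -/
noncomputable def Pseq (k : Type) [Field k] : ℕ → Polynomial k
  | 0 => 0
  | 1 => 1
  | (n + 2) => Polynomial.X * Pseq k (n + 1) + Pseq k n

/-- `Qseq k n` is the polynomial `Q_{n-1}`: `Q_{-1} = 0`, `Q_0 = 1`,
`Q_n = -X·Q_{n-1} + Q_{n-2}` for `n ≥ 1`. -/
noncomputable def Qseq (k : Type) [Field k] : ℕ → Polynomial k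
  | 0 => 0
  | 1 => 1
  | (n + 2) => -Polynomial.X * Qseq k (n + 1) + Qseq k n

theorem Polynomial.natDegree_Pseq_succ (k : Type) [Field k] (n : ℕ) :
    (Pseq k (n + 1)).natDegree = n ∧ Pseq k (n + 1) ≠ 0 := by
  induction n using Nat.twoStepInduction with
  | zero => simp [Pseq]
  | one => simp [Pseq]
  | more n ih0 ih1 =>
    have hX : (X * Pseq k (n + 2)).natDegree = n + 2 := by
      rw [natDegree_X_mul ih1.2, ih1.1]
    have hlt : (Pseq k (n + 1)).natDegree < (X * Pseq k (n + 2)).natDegree := by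
      rw [hX, ih0.1]
      omega
    have hd : (Pseq k (n + 3)).natDegree = n + 2 := by
      rw [Pseq, natDegree_add_eq_left_of_natDegree_lt hlt, hX]
    refine ⟨hd, fun h => ?_⟩
    rw [h] at hd
    simp at hd

theorem Qseq_succ_eq (k : Type) [Field k] (n : ℕ) :
    Qseq k (n + 1) = (-1) ^ n * Pseq k (n + 1) ∧ Qseq k n = -(-1) ^ n * Pseq k n := by
  induction n with
  | zero => simp [Qseq, Pseq]
  | succ n ih =>
    obtain ⟨h1, h2⟩ := ih
    refine ⟨?_, by rw [h1]; ring⟩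
    rw [Qseq, Pseq, h1, h2]
    ring

theorem Polynomial.Pseq_comp_neg_X (k : Type) [Field k] (n : ℕ) :
    (Pseq k (n + 1)).comp (-X) = (-1) ^ n * Pseq k (n + 1) ∧
      (Pseq k n).comp (-X) = -(-1) ^ n * Pseq k n := by
  induction n with
  | zero => simp [Pseq]
  | succ n ih =>
    obtain ⟨h1, h2⟩ := ih
    refine ⟨?_, by rw [h1]; ring⟩
    rw [Pseq, add_comp, mul_comp, X_comp, h1, h2]
    ring

theorem Polynomial.coeff_Pseq_even (k : Type) [Field k] (m : ℕ) :
    (Pseq k (2 * m + 1)).coeff 0 = 1 ∧ (Pseq k (2 * m)).coeff 0 = 0 ∧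
      (Pseq k (2 * m)).coeff 1 = m ∧
      2 * (Pseq k (2 * m + 1)).coeff 2 = (m * (m + 1) : k) := by
  induction m with
  | zero => simp [Pseq, coeff_one]
  | succ m ih =>
    obtain ⟨h1, h2, h3, h4⟩ := ih
    have e1 : Pseq k (2 * (m + 1)) = X * Pseq k (2 * m + 1) + Pseq k (2 * m) := by
      rw [mul_add, mul_one, Pseq]
    have e2 : Pseq k (2 * (m + 1) + 1) = X * Pseq k (2 * (m + 1)) + Pseq k (2 * m + 1) := by
      rw [show 2 * (m + 1) + 1 = 2 * m + 1 + 2 by ring, Pseq]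
      rfl
    have h5 : (Pseq k (2 * (m + 1))).coeff 1 = m + 1 := by
      rw [e1, coeff_add, coeff_X_mul, h1, h3, add_comm]
    refine ⟨by rw [e2]; simp [h1], by rw [e1]; simp [h2], by simpa using h5, ?_⟩
    rw [e2, coeff_add, coeff_X_mul, h5, mul_add, h4]
    push_cast
    ring

/-- In characteristic zero, a polynomial with a nonzero period is constant. -/
theorem Polynomial.eq_C_of_periodic {k : Type} [Field k] [CharZero k] {p : Polynomial k} {D : k}
    (hD : D ≠ 0) (h : ∀ x, p.eval (x + D) = p.eval x) : p = Polynomial.C (p.eval 0) := by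
  have hj : ∀ j : ℕ, p.eval (j * D) = p.eval 0 := by
    intro j
    induction j with
    | zero => simp
    | succ j ih => rw [← ih, ← h (j * D)]; push_cast; ring_nf
  refine eq_of_infinite_eval_eq _ _ (Set.Infinite.mono ?_
    (Set.infinite_range_of_injective (f := fun j : ℕ => (j : k) * D) ?_))
  · rintro _ ⟨j, rfl⟩
    simp [hj]
  · intro i j hij
    exact_mod_cast mul_right_cancel₀ hD hij

theorem Polynomial.Pseq_affine_symmetry {k : Type} [Field k] [CharZero k] {n : ℕ} (hn : 2 ≤ n)
    (hne : Even n) {c d e α : k} (he : e ≠ 0) (hc : c ≠ 0)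
    (h : C e * (Pseq k (n + 1)).comp (C c * X + C d) = C α * Pseq k (n + 1)) :
    d = 0 ∧ c ^ 2 = 1 ∧ e = α := by
  have hev : ∀ x, (Pseq k (n + 1)).eval (-x) = (Pseq k (n + 1)).eval x := by
    intro x
    simpa [hne.neg_one_pow] using congrArg (eval x) (Polynomial.Pseq_comp_neg_X k n).1
  obtain ⟨m, rfl⟩ := hne.exists_two_nsmul
  simp only [smul_eq_mul] at *
  obtain ⟨h0, -, -, h2⟩ := Polynomial.coeff_Pseq_even k m
  have hm : (m : k) * (m + 1) ≠ 0 := by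
    have : m ≠ 0 := by omega
    exact_mod_cast Nat.mul_ne_zero this (Nat.succ_ne_zero m)
  have h2' : (Pseq k (2 * m + 1)).coeff 2 ≠ 0 := by
    intro h'
    simp only [h', mul_zero] at h2
    exact hm h2.symm
  have hx : ∀ x, e * (Pseq k (2 * m + 1)).eval (c * x + d) = α * (Pseq k (2 * m + 1)).eval x := by
    intro x
    simpa using congrArg (eval x) h
  have hd : d = 0 := by
    by_contra hd
    have hp := Polynomial.eq_C_of_periodic (p := Pseq k (2 * m + 1)) (D := 2 * d)
      (mul_ne_zero two_ne_zero hd) (by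
        intro x
        have a1 := hx ((x + d) / c)
        have a2 := hx (-((x + d) / c))
        rw [hev, ← a1] at a2
        have a3 := mul_left_cancel₀ he a2
        rw [mul_neg, mul_div_cancel₀ _ hc, show -(x + d) + d = -x by ring, hev] at a3
        rw [a3]
        ring_nf)
    rw [hp] at h2'
    simp at h2'
  subst hd
  have hcoeff : ∀ i, e * ((Pseq k (2 * m + 1)).coeff i * c ^ i)
      = α * (Pseq k (2 * m + 1)).coeff i := by
    intro i
    simpa [comp_C_mul_X_coeff] using congrArg (coeff · i) h
  have hea : e = α := by simpa [h0] using hcoeff 0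
  refine ⟨rfl, ?_, hea⟩
  have := hcoeff 2
  rw [← hea] at this
  have := mul_left_cancel₀ he this
  exact mul_left_cancel₀ h2' (by rw [this, mul_one])

/-- The key computation in the proof that `f` is WPD (Lemma 7.9 of the paper):
the two substitution identities force `R = 0`, `b = d = 0`, `a² = c² = 1` and
`α = α' = e = c·a`. Here `P_m = Pseq k (m+1)` and `Q_m = Qseq k (m+1)`. -/
theorem wpd_key_equations (k : Type) [Field k] [CharZero k]
    (n : ℕ) (hn : 2 ≤ n) (hne : Even n)
    (a c e α α' : k) (ha : a ≠ 0) (hc : c ≠ 0) (he : e ≠ 0) (hα : α ≠ 0) (hα' : α' ≠ 0)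
    (b d β β' : k) (R : MvPolynomial (Fin 3) k)
    (hR : R ∈ supported k ({0, 2} : Set (Fin 3)))
    (heq1 : (C a * X 0 + C b)
          * Polynomial.aeval (C c * X 2 + C d : MvPolynomial (Fin 3) k) (Pseq k n)
        + (C e * X 1 + R)
          * Polynomial.aeval (C c * X 2 + C d : MvPolynomial (Fin 3) k) (Pseq k (n + 1))
      = C α * (X 0 * Polynomial.aeval (X 2 : MvPolynomial (Fin 3) k) (Pseq k n)
          + X 1 * Polynomial.aeval (X 2 : MvPolynomial (Fin 3) k) (Pseq k (n + 1))) + C β)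
    (heq2 : Polynomial.aeval (C a * X 0 + C b : MvPolynomial (Fin 3) k) (Qseq k (n + 1))
          * (C e * X 1 + R)
        + Polynomial.aeval (C a * X 0 + C b : MvPolynomial (Fin 3) k) (Qseq k n)
          * (C c * X 2 + C d)
      = C α' * (Polynomial.aeval (X 0 : MvPolynomial (Fin 3) k) (Qseq k (n + 1)) * X 1
          + Polynomial.aeval (X 0 : MvPolynomial (Fin 3) k) (Qseq k n) * X 2) + C β') :
    R = 0 ∧ b = 0 ∧ d = 0 ∧ a ^ 2 = 1 ∧ c ^ 2 = 1 ∧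
      α = c * a ∧ α' = c * a ∧ e = c * a := by
  have hQ : Qseq k (n + 1) = Pseq k (n + 1) := by
    rw [(Qseq_succ_eq k n).1, hne.neg_one_pow, one_mul]
  have hQ' : Qseq k n = -Pseq k n := by
    rw [(Qseq_succ_eq k n).2, hne.neg_one_pow, neg_one_mul]
  rw [hQ, hQ'] at heq2
  let φ : MvPolynomial (Fin 3) k →ₐ[k] MvPolynomial (Fin 3) k := aeval ![X 0, 0, X 2]
  have hφ0 : φ (X 0) = X 0 := by simp [φ]
  have hφ1 : φ (X 1) = 0 := by simp [φ]
  have hφ2 : φ (X 2) = X 2 := by simp [φ]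
  have hφC : ∀ r, φ (C r) = C r := fun r => by simp [φ, algebraMap_eq]
  have hφR : φ R = R := by
    conv_rhs => rw [← aeval_X_left_apply (R := k) R]
    refine eval₂Hom_congr' rfl ?_ rfl
    intro i hi _
    have := mem_supported.1 hR hi
    simp only [Set.mem_insert_iff, Set.mem_singleton_iff] at this
    rcases this with rfl | rfl <;> simp
  have h1 := congrArg φ heq1
  have h2 := congrArg φ heq2
  simp only [map_add, map_mul, ← Polynomial.aeval_algHom_apply, hφ0, hφ1, hφ2, hφC, hφR] at h1 h2
  have hX1 : (X 1 : MvPolynomial (Fin 3) k) ≠ 0 := X_ne_zero 1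
  have k1 : C e * Polynomial.aeval (C c * X 2 + C d : MvPolynomial (Fin 3) k) (Pseq k (n + 1))
      = C α * Polynomial.aeval (X 2 : MvPolynomial (Fin 3) k) (Pseq k (n + 1)) :=
    mul_right_cancel₀ hX1 (by linear_combination heq1 - h1)
  have k2 : C e * Polynomial.aeval (C a * X 0 + C b : MvPolynomial (Fin 3) k) (Pseq k (n + 1))
      = C α' * Polynomial.aeval (X 0 : MvPolynomial (Fin 3) k) (Pseq k (n + 1)) :=
    mul_right_cancel₀ hX1 (by linear_combination heq2 - h2)
  let ψ : MvPolynomial (Fin 3) k →ₐ[k] Polynomial k := aeval ![Polynomial.X, 0, 1]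
  have k1' := congrArg (aeval fun _ : Fin 3 => (Polynomial.X : Polynomial k)) k1
  have k2' := congrArg (aeval fun _ : Fin 3 => (Polynomial.X : Polynomial k)) k2
  simp only [map_add, map_mul, ← Polynomial.aeval_algHom_apply, aeval_X, aeval_C,
    Polynomial.algebraMap_eq] at k1' k2'
  simp only [← Polynomial.comp_eq_aeval, Polynomial.comp_X] at k1' k2'
  obtain ⟨rfl, hc2, hα_eq⟩ := Polynomial.Pseq_affine_symmetry (d := d) (α := α) hn hne he hc k1'
  obtain ⟨rfl, ha2, hα'_eq⟩ := Polynomial.Pseq_affine_symmetry (d := b) (α := α') hn hne he ha k2'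
  have hPa : Polynomial.aeval (C a * X 0 : MvPolynomial (Fin 3) k) (Pseq k (n + 1))
      = Polynomial.aeval (X 0 : MvPolynomial (Fin 3) k) (Pseq k (n + 1)) := by
    rw [hα'_eq] at k2
    simpa using mul_left_cancel₀ (by simpa using hα') k2
  have hPa' : Polynomial.aeval (C a * X 0 : MvPolynomial (Fin 3) k) (Pseq k n)
      = C a * Polynomial.aeval (X 0 : MvPolynomial (Fin 3) k) (Pseq k n) := by
    rcases sq_eq_sq_iff_eq_or_eq_neg.1 (ha2.trans (one_pow 2).symm) with rfl | rfl
    · simp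
    · have := congrArg (Polynomial.aeval (X 0 : MvPolynomial (Fin 3) k)) (Polynomial.Pseq_comp_neg_X k n).2
      simpa [hne.neg_one_pow, Polynomial.aeval_comp] using this
  simp only [map_zero, add_zero, map_neg, mul_zero, zero_add] at h2
  rw [hPa, hPa'] at h2
  have key : Polynomial.aeval (X 0 : MvPolynomial (Fin 3) k) (Pseq k (n + 1)) * R
      = C (c * a - α') * (Polynomial.aeval (X 0 : MvPolynomial (Fin 3) k) (Pseq k n) * X 2)
        + C β' := by
    rw [C_sub, C_mul]
    linear_combination h2
  have key' := congrArg ψ key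
  simp only [map_add, map_mul, ← Polynomial.aeval_algHom_apply, ψ, aeval_X, aeval_C,
    Polynomial.algebraMap_eq] at key'
  simp only [Matrix.cons_val, mul_one, Polynomial.aeval_X_left_apply] at key'
  obtain ⟨l, rfl⟩ : ∃ l, n = l + 2 := ⟨n - 2, by omega⟩
  have hdeg : (Polynomial.C (c * a - α') * Pseq k (l + 2) + Polynomial.C β').natDegree < l + 2 := by
    refine lt_of_le_of_lt (Polynomial.natDegree_add_C.le.trans
      (Polynomial.natDegree_C_mul_le _ _)) ?_
    rw [(Polynomial.natDegree_Pseq_succ k (l + 1)).1]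
    omega
  have hzero : Polynomial.C (c * a - α') * Pseq k (l + 2) + Polynomial.C β' = 0 := by
    by_contra hne0
    have := Polynomial.natDegree_le_of_dvd ⟨_, key'.symm⟩ hne0
    rw [(Polynomial.natDegree_Pseq_succ k (l + 2)).1] at this
    omega
  have hca : c * a - α' = 0 := by
    have hl : (Pseq k (l + 2)).coeff (l + 1) ≠ 0 := by
      have h3 := Polynomial.leadingCoeff_ne_zero.2 (Polynomial.natDegree_Pseq_succ k (l + 1)).2
      rwa [Polynomial.leadingCoeff, (Polynomial.natDegree_Pseq_succ k (l + 1)).1] at h3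
    have := congrArg (Polynomial.coeff · (l + 1)) hzero
    simp only [Polynomial.coeff_add, Polynomial.coeff_C_mul, Polynomial.coeff_zero,
      Polynomial.coeff_C_succ, add_zero] at this
    exact (mul_eq_zero.1 this).resolve_right hl
  have hβ : β' = 0 := by simpa [hca] using hzero
  have hR0 : R = 0 := by
    rw [hca, hβ] at key
    simp only [map_zero, zero_mul, add_zero] at key
    refine (mul_eq_zero.1 key).resolve_left fun h0 => ?_
    have := congrArg ψ h0
    simp only [← Polynomial.aeval_algHom_apply, ψ, aeval_X, map_zero] at this
    simp only [Matrix.cons_val, Polynomial.aeval_X_left_apply] at this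
    exact (Polynomial.natDegree_Pseq_succ k (l + 2)).2 this
  have hα'_val : α' = c * a := (sub_eq_zero.1 hca).symm
  have he_val : e = c * a := hα'_eq.trans hα'_val
  exact ⟨hR0, rfl, rfl, ha2, hc2, hα_eq ▸ he_val, hα'_val, he_val⟩
end
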